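/- arXiv:2206.08630 — 8 statements merged into one kernel-verified Lean document; each statement's English description precedes it below -/
import Mathlib

section
/- Suppose λσ = 1 and d₂ = 0. Fix an integer k ≥ 1, let ỹ* = y*/σ^k, define T̃₁ = T₁ ∘ T₀^k, and set d̃₁ = ∂ₓ(T̃₁)₂(0,ỹ*). Then d̃₁ = λ^k d₁, and consequently d̃₁·x*/ỹ* = d₁·x*/y*; that is, the quantity d₁x*/y* is unchanged when the homoclinic point (0,y*) on the y-axis is replaced by (0, y*/σ^k). -/
open Function

/-- Suppose `λσ = 1` and `d₂ = 0`. Fix `k ≥ 1`, let `ỹ* = y*/σ^k`, define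
`T̃₁ = T₁ ∘ T₀^k`, and set `d̃₁ = ∂ₓ(T̃₁)₂(0,ỹ*)`. Then `d̃₁ = λ^k d₁` and
`d̃₁·x*/ỹ* = d₁·x*/y*`. -/
theorem stmt_2 (lam sig : ℝ) (hlam0 : 0 < |lam|) (hlam1 : |lam| < 1) (hsig : 1 < |sig|)
    (F G : ℝ × ℝ → ℝ) (hF : ContDiff ℝ (⊤ : ℕ∞) F) (hG : ContDiff ℝ (⊤ : ℕ∞) G)
    (T₀ : ℝ × ℝ → ℝ × ℝ)
    (hT₀ : ∀ x y : ℝ, T₀ (x, y) =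
      (lam * x * (1 + x * y * F (x, y)), sig * y * (1 + x * y * G (x, y))))
    (T₁ : ℝ × ℝ → ℝ × ℝ) (hT₁ : ContDiff ℝ 1 T₁)
    (xs ys : ℝ) (hxs : 0 < xs) (hys : 0 < ys)
    (d₁ d₂ : ℝ)
    (hd₁ : d₁ = (fderiv ℝ T₁ (0, ys) (1, 0)).2)
    (hd₂ : d₂ = (fderiv ℝ T₁ (0, ys) (0, 1)).2)
    (hls : lam * sig = 1) (hd₂0 : d₂ = 0)
    (k : ℕ) (hk : 1 ≤ k) :
    (fderiv ℝ (T₁ ∘ T₀^[k]) (0, ys / sig ^ k) (1, 0)).2 = lam ^ k * d₁ ∧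
    (fderiv ℝ (T₁ ∘ T₀^[k]) (0, ys / sig ^ k) (1, 0)).2 * xs / (ys / sig ^ k) =
      d₁ * xs / ys := by
  have hT : T₀ = fun p : ℝ × ℝ => (lam * p.1 * (1 + p.1 * p.2 * F p),
      sig * p.2 * (1 + p.1 * p.2 * G p)) := by
    funext p
    exact hT₀ p.1 p.2
  have hFd : Differentiable ℝ F := hF.differentiable (by simp)
  have hGd : Differentiable ℝ G := hG.differentiable (by simp)
  have hTd : Differentiable ℝ T₀ := by
    rw [hT]
    fun_prop
  have hTk : ∀ n : ℕ, Differentiable ℝ (T₀^[n]) := fun n => hTd.iterate n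
  have hval : ∀ (n : ℕ) (y : ℝ), T₀^[n] (0, y) = (0, sig ^ n * y) := by
    intro n y
    induction n with
    | zero => simp
    | succ n ih =>
      rw [Function.iterate_succ_apply', ih, hT₀]
      ext
      · simp
      · simp; ring
  have hc : ∀ (n : ℕ) (y : ℝ), Differentiable ℝ (fun x : ℝ => T₀^[n] (x, y)) := by
    intro n y
    exact (hTk n).comp (by fun_prop : Differentiable ℝ (fun x : ℝ => (x, y)))
  have hder : ∀ (n : ℕ) (y : ℝ), HasDerivAt (fun x : ℝ => (T₀^[n] (x, y)).1) (lam ^ n) 0 := by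
    intro n y
    induction n with
    | zero => simpa using hasDerivAt_id' (0 : ℝ)
    | succ n ih =>
      have hcn := hc n y
      have hw : Differentiable ℝ (fun x : ℝ => (T₀^[n] (x, y)).2 * F (T₀^[n] (x, y))) :=
        hcn.snd.mul (hFd.comp hcn)
      have h1 := (ih.const_mul lam).mul ((ih.mul (hw 0).hasDerivAt).const_add 1)
      have e : (fun x : ℝ => (T₀^[n+1] (x, y)).1) = fun x : ℝ => (lam * (T₀^[n] (x, y)).1) *
          (1 + (T₀^[n] (x, y)).1 * ((T₀^[n] (x, y)).2 * F (T₀^[n] (x, y)))) := by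
        funext x
        rw [Function.iterate_succ_apply', hT]
        simp only [mul_assoc]
      rw [e]
      refine h1.congr_deriv ?_
      simp [hval]
      ring
  have hs0 : sig ≠ 0 := by
    rintro rfl
    simp at hls
  have hsk : sig ^ k ≠ 0 := pow_ne_zero k hs0
  have hpt : T₀^[k] (0, ys / sig ^ k) = (0, ys) := by
    rw [hval, mul_div_cancel₀ _ hsk]
  have hfst : (fderiv ℝ (T₀^[k]) (0, ys / sig ^ k) (1, 0)).1 = lam ^ k := by
    have hl : HasDerivAt (fun x : ℝ => (x, ys / sig ^ k)) ((1 : ℝ), (0 : ℝ)) 0 :=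
      (hasDerivAt_id (0 : ℝ)).prodMk (hasDerivAt_const _ _)
    have h1 := ((hTk k) (0, ys / sig ^ k)).hasFDerivAt.comp_hasDerivAt (0 : ℝ) hl
    have h2 := (hasFDerivAt_fst (𝕜 := ℝ) (E := ℝ) (F := ℝ)).comp_hasDerivAt (0 : ℝ) h1
    exact h2.unique (hder k _)
  have main : (fderiv ℝ (T₁ ∘ T₀^[k]) (0, ys / sig ^ k) (1, 0)).2 = lam ^ k * d₁ := by
    rw [fderiv_comp _ (hT₁.differentiable (by simp) _) (hTk k _), hpt,
      ContinuousLinearMap.comp_apply]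
    generalize fderiv ℝ (T₀^[k]) (0, ys / sig ^ k) (1, 0) = v at hfst
    have hv : v = v.1 • ((1 : ℝ), (0 : ℝ)) + v.2 • ((0 : ℝ), (1 : ℝ)) := by
      ext <;> simp
    rw [hv, map_add, map_smul, map_smul, Prod.snd_add, Prod.smul_snd, Prod.smul_snd,
      ← hd₁, ← hd₂, hd₂0, hfst]
    simp
  refine ⟨main, ?_⟩
  rw [main]
  have hp : lam ^ k * sig ^ k = 1 := by rw [← mul_pow, hls, one_pow]
  rw [div_div_eq_mul_div]
  congr 1
  linear_combination (d₁ * xs) * hp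
end

section
/- Suppose λσ = 1 and T₁(0,y*) = (x*,0). Fix an integer k ≥ 1, let x̃* = λ^k x*, define T̃₁ = T₀^k ∘ T₁, and set d̃₁ = ∂ₓ(T̃₁)₂(0,y*). Then d̃₁ = σ^k d₁, and consequently d̃₁·x̃*/y* = d₁·x*/y*; that is, the quantity d₁x*/y* is unchanged when the homoclinic point (x*,0) on the x-axis is replaced by (λ^k x*, 0). -/
open Function

/-- Suppose `λσ = 1` and `T₁(0,y*) = (x*,0)`. Fix `k ≥ 1`, let `x̃* = λ^k x*`,
define `T̃₁ = T₀^k ∘ T₁`, and set `d̃₁ = ∂ₓ(T̃₁)₂(0,y*)`. Then `d̃₁ = σ^k d₁` and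
`d̃₁·x̃*/y* = d₁·x*/y*`. -/
theorem stmt_3 (lam sig : ℝ) (hlam0 : 0 < |lam|) (hlam1 : |lam| < 1) (hsig : 1 < |sig|)
    (F G : ℝ × ℝ → ℝ) (hF : ContDiff ℝ (⊤ : ℕ∞) F) (hG : ContDiff ℝ (⊤ : ℕ∞) G)
    (T₀ : ℝ × ℝ → ℝ × ℝ)
    (hT₀ : ∀ x y : ℝ, T₀ (x, y) =
      (lam * x * (1 + x * y * F (x, y)), sig * y * (1 + x * y * G (x, y))))
    (T₁ : ℝ × ℝ → ℝ × ℝ) (hT₁ : ContDiff ℝ 1 T₁)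
    (xs ys : ℝ) (hxs : 0 < xs) (hys : 0 < ys)
    (d₁ d₂ : ℝ)
    (hd₁ : d₁ = (fderiv ℝ T₁ (0, ys) (1, 0)).2)
    (hd₂ : d₂ = (fderiv ℝ T₁ (0, ys) (0, 1)).2)
    (hls : lam * sig = 1) (hhom : T₁ (0, ys) = (xs, 0))
    (k : ℕ) (hk : 1 ≤ k) :
    (fderiv ℝ (T₀^[k] ∘ T₁) (0, ys) (1, 0)).2 = sig ^ k * d₁ ∧
    (fderiv ℝ (T₀^[k] ∘ T₁) (0, ys) (1, 0)).2 * (lam ^ k * xs) / ys = d₁ * xs / ys := by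
  have hGd : Differentiable ℝ G := hG.differentiable (by simp)
  have hFd : Differentiable ℝ F := hF.differentiable (by simp)
  have hT : T₀ = fun p : ℝ × ℝ => (lam * p.1 * (1 + p.1 * p.2 * F p),
      sig * p.2 * (1 + p.1 * p.2 * G p)) := by
    funext p
    exact hT₀ p.1 p.2
  have hTd : Differentiable ℝ T₀ := by
    rw [hT]
    fun_prop
  have hstep : ∀ (a : ℝ) (v : ℝ × ℝ), (fderiv ℝ T₀ (a, 0) v).2 = sig * v.2 := by
    intro a v
    have hu : HasFDerivAt (fun p : ℝ × ℝ => sig * p.2)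
        (sig • ContinuousLinearMap.snd ℝ ℝ ℝ) (a, 0) := hasFDerivAt_snd.const_mul sig
    have hw : DifferentiableAt ℝ (fun p : ℝ × ℝ => 1 + p.1 * p.2 * G p) (a, 0) := by
      fun_prop
    have h1 := hu.mul hw.hasFDerivAt
    have h2 : HasFDerivAt (fun p => (T₀ p).2) _ (a, 0) := (hTd (a, 0)).hasFDerivAt.snd
    have h3 : (fun p => (T₀ p).2) =
        (fun p : ℝ × ℝ => sig * p.2) * (fun p : ℝ × ℝ => 1 + p.1 * p.2 * G p) := by
      rw [hT]
      rfl
    rw [h3] at h2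
    have h4 := congrArg (fun L => L v) (h2.unique h1)
    simpa using h4
  have hmain : ∀ n : ℕ, DifferentiableAt ℝ (T₀^[n] ∘ T₁) (0, ys) ∧
      (T₀^[n] ∘ T₁) (0, ys) = (lam ^ n * xs, 0) ∧
      (fderiv ℝ (T₀^[n] ∘ T₁) (0, ys) (1, 0)).2 = sig ^ n * d₁ := by
    intro n
    induction n with
    | zero =>
      refine ⟨?_, ?_, ?_⟩
      · simpa using (hT₁.differentiable (by simp)) (0, ys)
      · simpa using hhom
      · simp [hd₁]
    | succ n ih =>
      obtain ⟨ih1, ih2, ih3⟩ := ih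
      have he : T₀^[n + 1] ∘ T₁ = T₀ ∘ (T₀^[n] ∘ T₁) := by
        rw [Function.iterate_succ', Function.comp_assoc]
      rw [he]
      refine ⟨(hTd _).comp _ ih1, ?_, ?_⟩
      · rw [Function.comp_apply, ih2, hT₀]
        ext
        · simp
          ring
        · simp
      · rw [fderiv_comp _ (hTd _) ih1, ih2, ContinuousLinearMap.comp_apply, hstep, ih3]
        ring
  have h := (hmain k).2.2
  refine ⟨h, ?_⟩
  rw [h]
  have hp : lam ^ k * sig ^ k = 1 := by rw [← mul_pow, hls, one_pow]
  congr 1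
  linear_combination d₁ * xs * hp
end

section
/- If there is a neighbourhood U of the origin in ℝ² such that det DT₀(x,y) = 1 for all (x,y) ∈ U (i.e., T₀ is area-preserving near the origin), then a₁ + b₁ = 0. -/
open Function

/-- The Jacobian matrix of a planar map at a point. -/
noncomputable def jacobian (f : ℝ × ℝ → ℝ × ℝ) (z : ℝ × ℝ) : Matrix (Fin 2) (Fin 2) ℝ :=
  !![(fderiv ℝ f z (1, 0)).1, (fderiv ℝ f z (0, 1)).1;
     (fderiv ℝ f z (1, 0)).2, (fderiv ℝ f z (0, 1)).2]

/-- If there is a neighbourhood `U` of the origin such that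
`det DT₀(x,y) = 1` for all `(x,y) ∈ U`, then `a₁ + b₁ = 0`. -/
theorem stmt_5 (lam : ℝ) (hlam0 : 0 < |lam|) (hlam1 : |lam| < 1)
    (A B : ℝ → ℝ) (hA : ContDiff ℝ (⊤ : ℕ∞) A) (hB : ContDiff ℝ (⊤ : ℕ∞) B)
    (T₀ : ℝ × ℝ → ℝ × ℝ)
    (hT₀ : ∀ x y : ℝ, T₀ (x, y) =
      (lam * x * (1 + x * y * A (x * y)), lam⁻¹ * y * (1 + x * y * B (x * y))))
    (a₁ b₁ : ℝ) (ha₁ : a₁ = A 0) (hb₁ : b₁ = B 0)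
    (hdet : ∃ U ∈ nhds ((0 : ℝ), (0 : ℝ)), ∀ p ∈ U, (jacobian T₀ p).det = 1) :
    a₁ + b₁ = 0 := by
  obtain ⟨U, hU, hdet⟩ := hdet
  have hlam : lam ≠ 0 := abs_pos.mp hlam0
  have hAd : Differentiable ℝ A := hA.differentiable (by simp)
  have hBd : Differentiable ℝ B := hB.differentiable (by simp)
  have hA' : Continuous (deriv A) := hA.continuous_deriv (by simp)
  have hB' : Continuous (deriv B) := hB.continuous_deriv (by simp)
  have hAc := hAd.continuous
  have hBc := hBd.continuous
  have hT : T₀ = fun p : ℝ × ℝ => (lam * p.1 * (1 + p.1 * p.2 * A (p.1 * p.2)),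
      lam⁻¹ * p.2 * (1 + p.1 * p.2 * B (p.1 * p.2))) := by
    funext p
    exact hT₀ p.1 p.2
  have hTd : Differentiable ℝ T₀ := by
    rw [hT]
    fun_prop
  -- partial derivatives
  have hx : ∀ x y : ℝ, fderiv ℝ T₀ (x, y) (1, 0) =
      (lam * (1 + x * y * A (x * y)) + lam * x * (y * A (x * y) + x * y * (deriv A (x * y) * y)),
       lam⁻¹ * y * (y * B (x * y) + x * y * (deriv B (x * y) * y))) := by
    intro x y
    have hc : HasDerivAt (fun s : ℝ => (s, y)) ((1 : ℝ), (0 : ℝ)) x :=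
      (hasDerivAt_id x).prodMk (hasDerivAt_const x y)
    have h1 := (hTd (x, y)).hasFDerivAt.comp_hasDerivAt x hc
    have hm : HasDerivAt (fun s : ℝ => s * y) y x := by
      simpa using (hasDerivAt_id x).mul_const y
    have hAm := HasDerivAt.comp x (hAd (x * y)).hasDerivAt hm
    have hBm := HasDerivAt.comp x (hBd (x * y)).hasDerivAt hm
    have h2 := (((hasDerivAt_id x).const_mul lam).mul ((hm.mul hAm).const_add 1)).prodMk
      (((hm.mul hBm).const_add 1).const_mul (lam⁻¹ * y))
    have h3 := h1.unique (h2.congr_of_eventuallyEq (Filter.Eventually.of_forall fun s => by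
      simp [hT₀]))
    rw [h3]
    simp
  have hy : ∀ x y : ℝ, fderiv ℝ T₀ (x, y) (0, 1) =
      (lam * x * (x * A (x * y) + x * y * (deriv A (x * y) * x)),
       lam⁻¹ * (1 + x * y * B (x * y)) +
        lam⁻¹ * y * (x * B (x * y) + x * y * (deriv B (x * y) * x))) := by
    intro x y
    have hc : HasDerivAt (fun s : ℝ => (x, s)) ((0 : ℝ), (1 : ℝ)) y :=
      (hasDerivAt_const y x).prodMk (hasDerivAt_id y)
    have h1 := (hTd (x, y)).hasFDerivAt.comp_hasDerivAt y hc
    have hm : HasDerivAt (fun s : ℝ => x * s) x y := by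
      simpa using (hasDerivAt_id y).const_mul x
    have hAm := HasDerivAt.comp y (hAd (x * y)).hasDerivAt hm
    have hBm := HasDerivAt.comp y (hBd (x * y)).hasDerivAt hm
    have h2 := (((hm.mul hAm).const_add 1).const_mul (lam * x)).prodMk
      (((hasDerivAt_id y).const_mul lam⁻¹).mul ((hm.mul hBm).const_add 1))
    have h3 := h1.unique (h2.congr_of_eventuallyEq (Filter.Eventually.of_forall fun s => by
      simp [hT₀]))
    rw [h3]
    simp
  let H : ℝ → ℝ := fun t => A (t * t) + B (t * t) + t * t * A (t * t) * B (t * t)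
    + (1 + t * t * A (t * t)) * (B (t * t) + t * t * deriv B (t * t))
    + (A (t * t) + t * t * deriv A (t * t)) * (1 + t * t * B (t * t))
  have hH : Continuous H := by
    have hq : Continuous fun t : ℝ => t * t := by fun_prop
    have e1 := hAc.comp hq
    have e2 := hBc.comp hq
    have e3 := hA'.comp hq
    have e4 := hB'.comp hq
    simp only [Function.comp_def] at e1 e2 e3 e4
    fun_prop
  have hev : ∀ᶠ t : ℝ in nhdsWithin 0 {0}ᶜ, H t = 0 := by
    have hd : Filter.Tendsto (fun t : ℝ => (t, t)) (nhds 0) (nhds ((0 : ℝ), (0 : ℝ))) :=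
      (continuous_id.prodMk continuous_id).tendsto (0 : ℝ)
    filter_upwards [nhdsWithin_le_nhds (hd hU), self_mem_nhdsWithin] with t ht ht0
    have ht0' : t ≠ 0 := ht0
    have h := hdet (t, t) ht
    rw [jacobian, Matrix.det_fin_two_of, hx, hy] at h
    have h5 : t * t * H t = 0 := by
      simp only [H, ← pow_two]
      field_simp at h
      linear_combination h
    simpa [ht0'] using h5
  have hlim : Filter.Tendsto H (nhdsWithin 0 {0}ᶜ) (nhds (H 0)) :=
    (hH.tendsto 0).mono_left nhdsWithin_le_nhds
  have h0 : H 0 = 0 :=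
    tendsto_nhds_unique hlim (tendsto_const_nhds.congr' (hev.mono fun t ht => ht.symm))
  simp [H] at h0
  rw [ha₁, hb₁]
  linarith
end

section
/- Let k ≥ 1 and let (x_j, y_j) for j = 0, …, k be points of ℝ² with (x_{j+1}, y_{j+1}) = T₀(x_j, y_j) for j = 0, …, k−1. If (x_j, y_j) ∈ 𝒩 and |x_j y_j| < η_R for all j = 0, …, k−1, then |y_{j+1}| ≥ |σ|^{1/2}|y_j| for each j = 0, …, k−1, and consequently |y₀| ≤ |σ|^{−k/2}|y_k|. -/
open Function

/-- If `(x_j,y_j) ∈ 𝒩` and `|x_j y_j| < η_R` for `j = 0,…,k−1`, where each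
`(x_{j+1},y_{j+1}) = T₀(x_j,y_j)`, then `|y_{j+1}| ≥ |σ|^{1/2}|y_j|` for each such `j`,
and consequently `|y₀| ≤ |σ|^{−k/2}|y_k|`. -/
theorem stmt_6 (lam sig : ℝ) (hlam0 : 0 < |lam|) (hlam1 : |lam| < 1) (hsig : 1 < |sig|)
    (F G : ℝ × ℝ → ℝ) (hF : ContDiff ℝ (⊤ : ℕ∞) F) (hG : ContDiff ℝ (⊤ : ℕ∞) G)
    (T₀ : ℝ × ℝ → ℝ × ℝ)
    (hT₀ : ∀ x y : ℝ, T₀ (x, y) =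
      (lam * x * (1 + x * y * F (x, y)), sig * y * (1 + x * y * G (x, y))))
    (N : Set (ℝ × ℝ)) (hN : Bornology.IsBounded N)
    (R : ℝ) (hR : 0 < R)
    (hFb : ∀ p ∈ N, |F p| ≤ R) (hGb : ∀ p ∈ N, |G p| ≤ R)
    (ηR : ℝ) (hηR : ηR = (1 - |sig| ^ (-(1 : ℝ) / 2)) / R)
    (k : ℕ) (hk : 1 ≤ k) (x y : ℕ → ℝ)
    (horb : ∀ j < k, (x (j + 1), y (j + 1)) = T₀ (x j, y j))
    (hin : ∀ j < k, (x j, y j) ∈ N ∧ |x j * y j| < ηR) :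
    (∀ j < k, |sig| ^ ((1 : ℝ) / 2) * |y j| ≤ |y (j + 1)|) ∧
    |y 0| ≤ |sig| ^ (-(k : ℝ) / 2) * |y k| := by
  have hs : 0 < |sig| := by linarith
  have step : ∀ j < k, |sig| ^ ((1 : ℝ) / 2) * |y j| ≤ |y (j + 1)| := by
    intro j hj
    obtain ⟨hm, hlt⟩ := hin j hj
    have h1 := horb j hj
    rw [hT₀] at h1
    have h2 : y (j + 1) = sig * y j * (1 + x j * y j * G (x j, y j)) :=
      congrArg Prod.snd h1
    have hg := hGb _ hm
    rw [hηR, lt_div_iff₀ hR] at hlt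
    have h3 : |x j * y j * G (x j, y j)| ≤ 1 - |sig| ^ (-(1 : ℝ) / 2) := by
      rw [abs_mul]
      exact (mul_le_mul_of_nonneg_left hg (abs_nonneg _)).trans hlt.le
    have h4 : |sig| ^ (-(1 : ℝ) / 2) ≤ |1 + x j * y j * G (x j, y j)| := by
      have h5 := neg_abs_le (x j * y j * G (x j, y j))
      have h6 := le_abs_self (1 + x j * y j * G (x j, y j))
      linarith
    have h7 : |sig| ^ ((1 : ℝ) / 2) = |sig| * |sig| ^ (-(1 : ℝ) / 2) := by
      rw [← Real.rpow_one_add' hs.le (by norm_num)]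
      norm_num
    rw [h2, abs_mul, abs_mul, h7]
    calc |sig| * |sig| ^ (-(1 : ℝ) / 2) * |y j|
        = |sig| * |y j| * |sig| ^ (-(1 : ℝ) / 2) := by ring
      _ ≤ _ := mul_le_mul_of_nonneg_left h4 (by positivity)
  refine ⟨step, ?_⟩
  have key : ∀ n : ℕ, n ≤ k → |y 0| ≤ |sig| ^ (-(n : ℝ) / 2) * |y n| := by
    intro n
    induction n with
    | zero => intro _; simp
    | succ n ih =>
      intro hn
      refine (ih (by omega)).trans ?_
      have h8 : |sig| ^ (-(n : ℝ) / 2)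
          = |sig| ^ (-((n + 1 : ℕ) : ℝ) / 2) * |sig| ^ ((1 : ℝ) / 2) := by
        rw [← Real.rpow_add hs]
        congr 1
        push_cast
        ring
      rw [h8, mul_assoc]
      exact mul_le_mul_of_nonneg_left (step n (by omega)) (by positivity)
  exact key k le_rfl
end

section
/- Suppose |λσ| ≤ 1 and let ω₀ > 0. Let k ≥ 1 be an integer satisfying (1 + 4ω₀²R|σ|^{−k/2})^k < 2 and (1 − 4ω₀²R|σ|^{−k/2})^k > 1/2. Let (x_j, y_j) for j = 0, …, k be points of ℝ² with (x_{j+1}, y_{j+1}) = T₀(x_j, y_j) and (x_j, y_j) ∈ 𝒩 for j = 0, …, k−1, and suppose |x₀| ≤ ω₀ and |y₀| ≤ ω₀|σ|^{−k/2}. Then for all j = 0, …, k: |x₀||λ|^j(1 − 4ω₀²R|σ|^{−k/2})^j ≤ |x_j| ≤ |x₀||λ|^j(1 + 4ω₀²R|σ|^{−k/2})^j and |y₀||σ|^j(1 − 4ω₀²R|σ|^{−k/2})^j ≤ |y_j| ≤ |y₀||σ|^j(1 + 4ω₀²R|σ|^{−k/2})^j. In particular, |x_j| ≤ 2ω₀|λ|^j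 for all j = 0, …, k. -/
open Function

/-- Under the stated smallness conditions on `k`, an orbit of `T₀` lying in `𝒩`
with `|x₀| ≤ ω₀` and `|y₀| ≤ ω₀|σ|^{−k/2}` satisfies the two-sided bounds
`|x₀||λ|^j(1 ∓ 4ω₀²R|σ|^{−k/2})^j ≤ |x_j| ≤ …` and likewise for `y_j`, for all
`j = 0,…,k`; in particular `|x_j| ≤ 2ω₀|λ|^j`. -/
theorem stmt_7 (lam sig : ℝ) (hlam0 : 0 < |lam|) (hlam1 : |lam| < 1) (hsig : 1 < |sig|)
    (F G : ℝ × ℝ → ℝ) (hF : ContDiff ℝ (⊤ : ℕ∞) F) (hG : ContDiff ℝ (⊤ : ℕ∞) G)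
    (T₀ : ℝ × ℝ → ℝ × ℝ)
    (hT₀ : ∀ x y : ℝ, T₀ (x, y) =
      (lam * x * (1 + x * y * F (x, y)), sig * y * (1 + x * y * G (x, y))))
    (N : Set (ℝ × ℝ)) (hN : Bornology.IsBounded N)
    (R : ℝ) (hR : 0 < R)
    (hFb : ∀ p ∈ N, |F p| ≤ R) (hGb : ∀ p ∈ N, |G p| ≤ R)
    (hls : |lam * sig| ≤ 1)
    (ω₀ : ℝ) (hω₀ : 0 < ω₀)
    (k : ℕ) (hk : 1 ≤ k)
    (hkU : (1 + 4 * ω₀ ^ 2 * R * |sig| ^ (-(k : ℝ) / 2)) ^ k < 2)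
    (hkL : (1 / 2 : ℝ) < (1 - 4 * ω₀ ^ 2 * R * |sig| ^ (-(k : ℝ) / 2)) ^ k)
    (x y : ℕ → ℝ)
    (horb : ∀ j < k, (x (j + 1), y (j + 1)) = T₀ (x j, y j))
    (hin : ∀ j < k, (x j, y j) ∈ N)
    (hx0 : |x 0| ≤ ω₀) (hy0 : |y 0| ≤ ω₀ * |sig| ^ (-(k : ℝ) / 2)) :
    (∀ j ≤ k,
      |x 0| * |lam| ^ j * (1 - 4 * ω₀ ^ 2 * R * |sig| ^ (-(k : ℝ) / 2)) ^ j ≤ |x j| ∧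
      |x j| ≤ |x 0| * |lam| ^ j * (1 + 4 * ω₀ ^ 2 * R * |sig| ^ (-(k : ℝ) / 2)) ^ j ∧
      |y 0| * |sig| ^ j * (1 - 4 * ω₀ ^ 2 * R * |sig| ^ (-(k : ℝ) / 2)) ^ j ≤ |y j| ∧
      |y j| ≤ |y 0| * |sig| ^ j * (1 + 4 * ω₀ ^ 2 * R * |sig| ^ (-(k : ℝ) / 2)) ^ j) ∧
    (∀ j ≤ k, |x j| ≤ 2 * ω₀ * |lam| ^ j) := by
  have hs : 0 < |sig| ^ (-(k : ℝ) / 2) := Real.rpow_pos_of_pos (by linarith) _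
  generalize |sig| ^ (-(k : ℝ) / 2) = s at *
  obtain ⟨e, he⟩ : ∃ e, e = 4 * ω₀ ^ 2 * R * s := ⟨_, rfl⟩
  rw [← he] at hkU hkL
  simp only [← he]
  have he0 : 0 < e := by rw [he]; positivity
  have hpow : ∀ j ≤ k, (1 + e) ^ j < 2 := fun j hj =>
    lt_of_le_of_lt (pow_le_pow_right₀ (by linarith) hj) hkU
  have he1 : e < 1 := by
    have := hpow 1 hk
    rw [pow_one] at this
    linarith
  have h1e : 0 < 1 - e := by linarith
  have fac : ∀ t : ℝ, |t| ≤ e → 1 - e ≤ |1 + t| ∧ |1 + t| ≤ 1 + e := by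
    intro t ht
    obtain ⟨h1, h2⟩ := abs_le.mp ht
    rw [abs_of_nonneg (by linarith)]
    constructor <;> linarith
  have main : ∀ j ≤ k,
      |x 0| * |lam| ^ j * (1 - e) ^ j ≤ |x j| ∧
      |x j| ≤ |x 0| * |lam| ^ j * (1 + e) ^ j ∧
      |y 0| * |sig| ^ j * (1 - e) ^ j ≤ |y j| ∧
      |y j| ≤ |y 0| * |sig| ^ j * (1 + e) ^ j := by
    intro j
    induction j with
    | zero => intro _; simp
    | succ j ih =>
      intro hj
      have hjk : j < k := hj
      obtain ⟨a1, a2, a3, a4⟩ := ih hjk.le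
      have hxy : |x j * y j| ≤ 4 * ω₀ ^ 2 * s := by
        have hp := hpow j hjk.le
        have hp0 : 0 < (1 + e) ^ j := by positivity
        have hls' : (|lam| * |sig|) ^ j ≤ 1 := by
          rw [← abs_mul]
          exact pow_le_one₀ (abs_nonneg _) hls
        have hpp : (1 + e) ^ j * (1 + e) ^ j ≤ 4 := by nlinarith
        have h0 : |x 0| * |y 0| ≤ ω₀ * (ω₀ * s) :=
          mul_le_mul hx0 hy0 (abs_nonneg _) hω₀.le
        calc |x j * y j| = |x j| * |y j| := abs_mul _ _
          _ ≤ (|x 0| * |lam| ^ j * (1 + e) ^ j) * (|y 0| * |sig| ^ j * (1 + e) ^ j) :=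
            mul_le_mul a2 a4 (abs_nonneg _) (by positivity)
          _ = (|x 0| * |y 0|) * (|lam| * |sig|) ^ j * ((1 + e) ^ j * (1 + e) ^ j) := by
            rw [mul_pow]; ring
          _ ≤ (ω₀ * (ω₀ * s)) * 1 * 4 := by gcongr
          _ = 4 * ω₀ ^ 2 * s := by ring
      have small : ∀ c : ℝ, |c| ≤ R → |x j * y j * c| ≤ e := by
        intro c hc
        rw [abs_mul, he]
        calc |x j * y j| * |c| ≤ (4 * ω₀ ^ 2 * s) * R :=
              mul_le_mul hxy hc (abs_nonneg _) (by positivity)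
          _ = _ := by ring
      have step : ∀ (a u z b t : ℝ), |t| ≤ e →
          (a * |b| ^ j * (1 - e) ^ j ≤ |z| → a * |b| ^ (j+1) * (1 - e) ^ (j+1) ≤ |b * z * (1 + t)|) ∧
          (|z| ≤ u * |b| ^ j * (1 + e) ^ j →
            |b * z * (1 + t)| ≤ u * |b| ^ (j+1) * (1 + e) ^ (j+1)) := by
        intro a u z b t ht
        obtain ⟨f1, f2⟩ := fac t ht
        rw [abs_mul, abs_mul]
        constructor
        · intro h
          calc _ = |b| * (a * |b| ^ j * (1 - e) ^ j) * (1 - e) := by ring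
            _ ≤ |b| * |z| * (1 - e) := by gcongr
            _ ≤ _ := by gcongr
        · intro h
          calc _ ≤ |b| * |z| * (1 + e) := by gcongr
            _ ≤ |b| * (u * |b| ^ j * (1 + e) ^ j) * (1 + e) := by gcongr
            _ = _ := by ring
      have ho := horb j hjk
      rw [hT₀, Prod.mk.injEq] at ho
      rw [ho.1, ho.2]
      have sF := small _ (hFb _ (hin j hjk))
      have sG := small _ (hGb _ (hin j hjk))
      exact ⟨(step _ 0 _ _ _ sF).1 a1, (step 0 _ _ _ _ sF).2 a2,
        (step _ 0 _ _ _ sG).1 a3, (step 0 _ _ _ _ sG).2 a4⟩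
  refine ⟨main, fun j hj => (main j hj).2.1.trans ?_⟩
  calc |x 0| * |lam| ^ j * (1 + e) ^ j ≤ ω₀ * |lam| ^ j * 2 := by
        gcongr
        exact (hpow j hj).le
    _ = _ := by ring
end

section
/- For every ω > 0 there exists α > 0 such that for all integers k ≥ 1, all j ∈ {0, …, k−1}, and every point (x,y) ∈ 𝒩 with |x| ≤ ω|σ|^{−j} and |y| ≤ ω|σ|^{j−k}, the Jacobian matrix DT₀(x,y) = [[p, q],[r, s]] satisfies |p − λ| ≤ α|σ|^{−k}, |q| ≤ α|σ|^{−2j}, |r| ≤ α|σ|^{2(j−k)}, and |s − σ| ≤ α|σ|^{−k}. -/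
open Function

theorem aux_bdd (N : Set (ℝ × ℝ)) (hN : Bornology.IsBounded N) (h : ℝ × ℝ → ℝ)
    (hh : Continuous h) : ∃ C : ℝ, ∀ p ∈ N, |h p| ≤ C := by
  obtain ⟨C, hC⟩ := hN.isCompact_closure.exists_bound_of_continuousOn hh.continuousOn
  exact ⟨C, fun p hp => hC p (subset_closure hp)⟩

theorem aux_est (a b ω C D A B u v : ℝ) (hA : 0 ≤ A)
    (ha : |a| ≤ ω * A) (hb : |b| ≤ ω * B) (hu : |u| ≤ C) (hCD : C ≤ D)
    (hω : 0 < ω) (hv : A * B = v) : |a * b * u| ≤ (ω ^ 2 * D) * v := by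
  rw [abs_mul, abs_mul, ← hv]
  have h1 : |a| * |b| ≤ (ω * A) * (ω * B) :=
    mul_le_mul ha hb (abs_nonneg _) (by positivity)
  have h2 : |a| * |b| * |u| ≤ ((ω * A) * (ω * B)) * D :=
    mul_le_mul h1 (hu.trans hCD) (abs_nonneg _) (le_trans (by positivity) h1)
  linarith [h2]

/-- For every `ω > 0` there exists `α > 0` such that for all `k ≥ 1`,
`j ∈ {0,…,k−1}`, and `(x,y) ∈ 𝒩` with `|x| ≤ ω|σ|^{−j}` and `|y| ≤ ω|σ|^{j−k}`, the
Jacobian matrix `DT₀(x,y) = [[p,q],[r,s]]` satisfies `|p − λ| ≤ α|σ|^{−k}`,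
`|q| ≤ α|σ|^{−2j}`, `|r| ≤ α|σ|^{2(j−k)}`, `|s − σ| ≤ α|σ|^{−k}`. -/
theorem stmt_8 (lam sig : ℝ) (hlam0 : 0 < |lam|) (hlam1 : |lam| < 1) (hsig : 1 < |sig|)
    (F G : ℝ × ℝ → ℝ) (hF : ContDiff ℝ (⊤ : ℕ∞) F) (hG : ContDiff ℝ (⊤ : ℕ∞) G)
    (T₀ : ℝ × ℝ → ℝ × ℝ)
    (hT₀ : ∀ x y : ℝ, T₀ (x, y) =
      (lam * x * (1 + x * y * F (x, y)), sig * y * (1 + x * y * G (x, y))))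
    (N : Set (ℝ × ℝ)) (hN : Bornology.IsBounded N) :
    ∀ ω > (0 : ℝ), ∃ α > (0 : ℝ), ∀ k : ℕ, 1 ≤ k → ∀ j < k, ∀ x y : ℝ,
      (x, y) ∈ N → |x| ≤ ω * |sig| ^ (-(j : ℤ)) → |y| ≤ ω * |sig| ^ ((j : ℤ) - (k : ℤ)) →
      |(fderiv ℝ T₀ (x, y) (1, 0)).1 - lam| ≤ α * |sig| ^ (-(k : ℤ)) ∧
      |(fderiv ℝ T₀ (x, y) (0, 1)).1| ≤ α * |sig| ^ (-2 * (j : ℤ)) ∧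
      |(fderiv ℝ T₀ (x, y) (1, 0)).2| ≤ α * |sig| ^ (2 * ((j : ℤ) - (k : ℤ))) ∧
      |(fderiv ℝ T₀ (x, y) (0, 1)).2 - sig| ≤ α * |sig| ^ (-(k : ℤ)) := by
  intro ω hω
  have hFd : Differentiable ℝ F := hF.differentiable (by simp)
  have hGd : Differentiable ℝ G := hG.differentiable (by simp)
  have hF' : Continuous (fderiv ℝ F) := hF.continuous_fderiv (by simp)
  have hG' : Continuous (fderiv ℝ G) := hG.continuous_fderiv (by simp)
  have hFc := hF.continuous
  have hGc := hG.continuous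
  obtain ⟨C1, hC1⟩ := aux_bdd N hN
    (fun p => lam * (2 * F p + p.1 * fderiv ℝ F p (1, 0))) (by fun_prop)
  obtain ⟨C2, hC2⟩ := aux_bdd N hN
    (fun p => lam * (F p + p.2 * fderiv ℝ F p (0, 1))) (by fun_prop)
  obtain ⟨C3, hC3⟩ := aux_bdd N hN
    (fun p => sig * (G p + p.1 * fderiv ℝ G p (1, 0))) (by fun_prop)
  obtain ⟨C4, hC4⟩ := aux_bdd N hN
    (fun p => sig * (2 * G p + p.2 * fderiv ℝ G p (0, 1))) (by fun_prop)
  have hD1 : C1 ≤ |C1| + |C2| + |C3| + |C4| + 1 := by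
    linarith [le_abs_self C1, abs_nonneg C2, abs_nonneg C3, abs_nonneg C4]
  have hD2 : C2 ≤ |C1| + |C2| + |C3| + |C4| + 1 := by
    linarith [le_abs_self C2, abs_nonneg C1, abs_nonneg C3, abs_nonneg C4]
  have hD3 : C3 ≤ |C1| + |C2| + |C3| + |C4| + 1 := by
    linarith [le_abs_self C3, abs_nonneg C2, abs_nonneg C1, abs_nonneg C4]
  have hD4 : C4 ≤ |C1| + |C2| + |C3| + |C4| + 1 := by
    linarith [le_abs_self C4, abs_nonneg C2, abs_nonneg C3, abs_nonneg C1]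
  refine ⟨ω ^ 2 * (|C1| + |C2| + |C3| + |C4| + 1), by positivity, ?_⟩
  intro k _ j _ x y hxy hx hy
  have hs0 : |sig| ≠ 0 := by linarith
  have hT : T₀ = fun p => (lam * p.1 * (1 + p.1 * p.2 * F p),
      sig * p.2 * (1 + p.1 * p.2 * G p)) := by
    funext p
    exact hT₀ p.1 p.2
  have h1 : HasFDerivAt (fun p : ℝ × ℝ => p.1) (ContinuousLinearMap.fst ℝ ℝ ℝ) (x, y) :=
    hasFDerivAt_fst
  have h2 : HasFDerivAt (fun p : ℝ × ℝ => p.2) (ContinuousLinearMap.snd ℝ ℝ ℝ) (x, y) :=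
    hasFDerivAt_snd
  have hf := (h1.const_mul lam).mul (((h1.mul h2).mul (hFd (x, y)).hasFDerivAt).const_add 1)
  have hg := (h2.const_mul sig).mul (((h1.mul h2).mul (hGd (x, y)).hasFDerivAt).const_add 1)
  have hTd := (hf.prodMk hg).fderiv
  have hTe := (congrArg (fun f => fderiv ℝ f (x, y)) hT).trans hTd
  dsimp only at hTe
  have hA : 0 ≤ |sig| ^ (-(j : ℤ)) := by positivity
  have hB : 0 ≤ |sig| ^ ((j : ℤ) - (k : ℤ)) := by positivity
  have e1 := aux_est x y ω _ _ _ _ _ (|sig| ^ (-(k : ℤ))) hA hx hy (hC1 _ hxy) hD1 hω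
    (by rw [← zpow_add₀ hs0]; congr 1; ring)
  have e2 := aux_est x x ω _ _ _ _ _ (|sig| ^ (-2 * (j : ℤ))) hA hx hx (hC2 _ hxy) hD2 hω
    (by rw [← zpow_add₀ hs0]; congr 1; ring)
  have e3 := aux_est y y ω _ _ _ _ _ (|sig| ^ (2 * ((j : ℤ) - (k : ℤ)))) hB hy hy
    (hC3 _ hxy) hD3 hω (by rw [← zpow_add₀ hs0]; congr 1; ring)
  have e4 := aux_est x y ω _ _ _ _ _ (|sig| ^ (-(k : ℤ))) hA hx hy (hC4 _ hxy) hD4 hω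
    (by rw [← zpow_add₀ hs0]; congr 1; ring)
  rw [hTe]
  refine ⟨?_, ?_, ?_, ?_⟩
  · convert e1 using 2
    simp
    ring
  · convert e2 using 2
    simp
    ring
  · convert e3 using 2
    simp
    ring
  · convert e4 using 2
    simp
    ring
end

section
/- There exists an integer k₀ ≥ 1 such that for every k ≥ k₀ the following holds: if M₀, …, M_{k−1} are real 2×2 matrices, M_j = [[p_j, q_j],[r_j, s_j]], satisfying |p_j − λ| ≤ α|σ|^{−k}, |q_j| ≤ α|σ|^{−2j}, |r_j| ≤ α|σ|^{2(j−k)}, and |s_j − σ| ≤ α|σ|^{−k} for every j ∈ {0, …, k−1}, then the products P_j = M_{j−1}⋯M₁M₀ = [[t_j, u_j],[v_j, w_j]] satisfy |t_j − λ^j| ≤ βj|σ|^{−(j+k)}, |u_j| ≤ βj|σ|^{−j}, |v_j| ≤ βj|σ|^{j−2k}, and |w_j − σ^j| ≤ βj|σ|^{j−k} for every j ∈ {1, …, k}. -/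
open Function

/-- Triangle inequality for a two-term product expression with a main part. -/
lemma aux_tri {a b c d e : ℝ} {A B C D : ℝ} (l m : ℝ)
    (h : e = a * b + c * d) (hA : |a - l| ≤ A) (hB : |b - m| ≤ B) (hC : |c| ≤ C) (hD : |d| ≤ D) :
    |e - l * m| ≤ (|l| + A) * B + A * |m| + C * D := by
  have e1 : e - l * m = (l + (a - l)) * (b - m) + (a - l) * m + c * d := by rw [h]; ring
  have hA0 : 0 ≤ A := (abs_nonneg _).trans hA
  have hC0 : 0 ≤ C := (abs_nonneg _).trans hC
  rw [e1]
  refine (abs_add_le _ _).trans (add_le_add ((abs_add_le _ _).trans (add_le_add ?_ ?_)) ?_)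
  · rw [abs_mul]
    have := abs_add_le l (a - l)
    exact mul_le_mul (by linarith) hB (abs_nonneg _) (by positivity)
  · rw [abs_mul]; gcongr
  · rw [abs_mul]; gcongr

lemma aux_step (L S z α β n x y e lj : ℝ) (hL : 0 < L) (hS : 1 < S) (hz : 0 < z) (hSz : S * z = 1)
    (hLz : L ≤ z) (hα : 0 < α) (hab : 2 * α ≤ β * z) (hn : 0 ≤ n) (hx : 0 < x) (hy : 0 < y)
    (hxy : x * y = 1) (he : 0 < e) (he1 : e ≤ 1) (hc : 4 * (α * n * e) ≤ z)
    (hlj0 : 0 ≤ lj) (hlj : lj ≤ y) :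
    (L + α * e) * (β * n * (y * e)) + α * e * lj + α * y ^ 2 * (β * n * (x * e ^ 2))
        ≤ β * (n + 1) * (y * z * e) ∧
    (L + α * e) * (β * n * y) + (α * y ^ 2) * (x + β * n * (x * e)) ≤ β * (n + 1) * (y * z) ∧
    (S + α * e) * (β * n * (x * e ^ 2)) + (α * (x ^ 2 * e ^ 2)) * (lj + β * n * (y * e))
      ≤ β * (n + 1) * (x * S * e ^ 2) ∧
    (S + α * e) * (β * n * (x * e)) + α * e * x + α * (x ^ 2 * e ^ 2) * (β * n * y)
      ≤ β * (n + 1) * (x * S * e) := by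
  have hβ : 0 < β := by
    by_contra h
    push Not at h
    nlinarith
  have hz1 : z ≤ S := by nlinarith
  have hc' : 4 * (α * n * e) ≤ S := hc.trans hz1
  have hab' : 2 * α ≤ β * S := hab.trans (by gcongr)
  have hyx : α * y ^ 2 * x = α * y := by linear_combination α * y * hxy
  have hxy2 : α * x ^ 2 * y = α * x := by linear_combination α * x * hxy
  refine ⟨?_, ?_, ?_, ?_⟩
  · have h1 : L * (β * n * (y * e)) ≤ z * (β * n * (y * e)) := by gcongr
    have h2 : 4 * (α * n * e) * (β * y * e) ≤ z * (β * y * e) := by gcongr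
    have h3 : 2 * α * (e * y) ≤ β * z * (e * y) := by gcongr
    have h4 : α * e * lj ≤ α * e * y := by gcongr
    have h5 : α * y ^ 2 * (β * n * (x * e ^ 2)) = (α * n * e) * (β * y * e) := by
      linear_combination (β * n * e ^ 2) * hyx
    rw [h5]; linarith
  · have h1 : L * (β * n * y) ≤ z * (β * n * y) := by gcongr
    have h2 : 4 * (α * n * e) * (β * y) ≤ z * (β * y) := by gcongr
    have h3 : 2 * α * y ≤ β * z * y := by gcongr
    have h5 : α * y ^ 2 * (x + β * n * (x * e)) = α * y + (α * n * e) * (β * y) := by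
      linear_combination (1 + β * n * e) * hyx
    rw [h5]; linarith
  · have h2 : 4 * (α * n * e) * (β * x * e ^ 2) ≤ S * (β * x * e ^ 2) := by gcongr
    have h3 : 2 * α * (x * e ^ 2) ≤ β * S * (x * e ^ 2) := by gcongr
    have h4 : α * (x ^ 2 * e ^ 2) * lj ≤ α * (x ^ 2 * e ^ 2) * y := by gcongr
    have h5 : α * (x ^ 2 * e ^ 2) * y = α * (x * e ^ 2) := by
      linear_combination (e ^ 2) * hxy2
    have h6 : α * (x ^ 2 * e ^ 2) * (β * n * (y * e)) = (α * n * e) * (β * x * e ^ 2) := by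
      linear_combination (β * n * e ^ 3) * hxy2
    rw [mul_add (α * (x ^ 2 * e ^ 2)), h6]; linarith
  · have h2 : 4 * (α * n * e) * (β * x * e) ≤ S * (β * x * e) := by gcongr
    have h3 : 2 * α * (x * e) ≤ β * S * (x * e) := by gcongr
    have h6 : α * (x ^ 2 * e ^ 2) * (β * n * y) = (α * n * e) * (β * x * e) := by
      linear_combination (β * n * e ^ 2) * hxy2
    rw [h6]; linarith

/-- There exists `k₀ ≥ 1` such that for every `k ≥ k₀`: if 2×2 matrices
`M₀,…,M_{k−1}` satisfy the entrywise bounds `|p_j − λ| ≤ α|σ|^{−k}`, `|q_j| ≤ α|σ|^{−2j}`,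
`|r_j| ≤ α|σ|^{2(j−k)}`, `|s_j − σ| ≤ α|σ|^{−k}`, then the products `P_j = M_{j−1}⋯M₀`
satisfy `|t_j − λ^j| ≤ βj|σ|^{−(j+k)}`, `|u_j| ≤ βj|σ|^{−j}`, `|v_j| ≤ βj|σ|^{j−2k}`,
`|w_j − σ^j| ≤ βj|σ|^{j−k}` for every `j ∈ {1,…,k}`, where `β = 2α/|λ|`. -/
theorem stmt_9 (lam sig α β : ℝ) (hlam0 : 0 < |lam|) (hlam1 : |lam| < 1) (hsig : 1 < |sig|)
    (hls : |lam * sig| ≤ 1) (hα : 0 < α) (hβ : β = 2 * α / |lam|) :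
    ∃ k₀ : ℕ, 1 ≤ k₀ ∧ ∀ k, k₀ ≤ k → ∀ M : ℕ → Matrix (Fin 2) (Fin 2) ℝ,
      (∀ j < k,
        |M j 0 0 - lam| ≤ α * |sig| ^ (-(k : ℤ)) ∧
        |M j 0 1| ≤ α * |sig| ^ (-2 * (j : ℤ)) ∧
        |M j 1 0| ≤ α * |sig| ^ (2 * ((j : ℤ) - (k : ℤ))) ∧
        |M j 1 1 - sig| ≤ α * |sig| ^ (-(k : ℤ))) →
      ∀ P : ℕ → Matrix (Fin 2) (Fin 2) ℝ,
        P 0 = 1 → (∀ j, P (j + 1) = M j * P j) →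
        ∀ j, 1 ≤ j → j ≤ k →
          |P j 0 0 - lam ^ j| ≤ β * (j : ℝ) * |sig| ^ (-((j : ℤ) + (k : ℤ))) ∧
          |P j 0 1| ≤ β * (j : ℝ) * |sig| ^ (-(j : ℤ)) ∧
          |P j 1 0| ≤ β * (j : ℝ) * |sig| ^ ((j : ℤ) - 2 * (k : ℤ)) ∧
          |P j 1 1 - sig ^ j| ≤ β * (j : ℝ) * |sig| ^ ((j : ℤ) - (k : ℤ)) := by
  have hS0 : 0 < |sig| := by linarith
  have hSne : |sig| ≠ 0 := hS0.ne'
  set S := |sig| with hSdef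
  have hLz : |lam| ≤ S⁻¹ := by
    rw [abs_mul] at hls
    rw [← one_div, le_div_iff₀ hS0]; exact hls
  have hβ0 : 0 < β := by rw [hβ]; positivity
  have hab : 2 * α ≤ β * S⁻¹ := by
    have : 2 * α = β * |lam| := by rw [hβ]; field_simp
    rw [this]; gcongr
  have hlim : Filter.Tendsto (fun k : ℕ => (k : ℝ) * S⁻¹ ^ k) Filter.atTop (nhds 0) :=
    tendsto_self_mul_const_pow_of_lt_one (by positivity) (inv_lt_one_of_one_lt₀ hsig)
  have hev : ∀ᶠ k : ℕ in Filter.atTop, (k : ℝ) * S⁻¹ ^ k < S⁻¹ / (4 * α) :=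
    hlim.eventually_lt_const (by positivity)
  obtain ⟨k₁, hk₁⟩ := Filter.eventually_atTop.1 hev
  refine ⟨max k₁ 1, le_max_right _ _, ?_⟩
  intro k hk M hM P hP0 hP j hj1 hjk
  clear hj1
  have hkk := hk₁ k ((le_max_left _ _).trans hk)
  have ek : S ^ (-(k : ℤ)) = S⁻¹ ^ k := by rw [zpow_neg, zpow_natCast, inv_pow]
  have zz : ∀ n : ℤ, S ^ (n + 1) = S ^ n * S := fun n => zpow_add_one₀ hSne n
  induction j with
  | zero => simp [hP0]
  | succ j ih =>
    obtain ⟨i1, i2, i3, i4⟩ := ih (by omega)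
    obtain ⟨m1, m2, m3, m4⟩ := hM j (by omega)
    have he : 0 < S ^ (-(k : ℤ)) := by positivity
    have he1 : S ^ (-(k : ℤ)) ≤ 1 := by
      rw [ek]; exact pow_le_one₀ (by positivity) (inv_le_one_of_one_le₀ hsig.le)
    have hc : 4 * (α * (j : ℝ) * S ^ (-(k : ℤ))) ≤ S⁻¹ := by
      rw [lt_div_iff₀ (by positivity), ← ek] at hkk
      have hjk' : (j : ℝ) ≤ k := by exact_mod_cast (by omega : j ≤ k)
      have : 4 * (α * (j : ℝ) * S ^ (-(k : ℤ))) ≤ 4 * (α * (k : ℝ) * S ^ (-(k : ℤ))) := by gcongr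
      linarith
    have hx : 0 < S ^ (j : ℤ) := by positivity
    have hy : 0 < S ^ (-(j : ℤ)) := by positivity
    have hxy : S ^ (j : ℤ) * S ^ (-(j : ℤ)) = 1 := by rw [← zpow_add₀ hSne]; simp
    have hlj : |lam| ^ j ≤ S ^ (-(j : ℤ)) := by
      rw [zpow_neg, zpow_natCast, ← inv_pow]; gcongr
    have hsj : |sig ^ j| = S ^ (j : ℤ) := by rw [abs_pow, zpow_natCast]
    have r1 : S ^ (-((j : ℤ) + (k : ℤ))) = S ^ (-(j : ℤ)) * S ^ (-(k : ℤ)) := by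
      rw [← zpow_add₀ hSne]; congr 1; ring
    have r2 : S ^ ((j : ℤ) - 2 * (k : ℤ)) = S ^ (j : ℤ) * (S ^ (-(k : ℤ))) ^ 2 := by
      rw [pow_two, ← zpow_add₀ hSne, ← zpow_add₀ hSne]; congr 1; ring
    have r3 : S ^ ((j : ℤ) - (k : ℤ)) = S ^ (j : ℤ) * S ^ (-(k : ℤ)) := by
      rw [← zpow_add₀ hSne]; congr 1
    have r4 : S ^ (-2 * (j : ℤ)) = (S ^ (-(j : ℤ))) ^ 2 := by
      rw [pow_two, ← zpow_add₀ hSne]; congr 1; ring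
    have r5 : S ^ (2 * ((j : ℤ) - (k : ℤ))) = (S ^ (j : ℤ)) ^ 2 * (S ^ (-(k : ℤ))) ^ 2 := by
      rw [pow_two, pow_two, ← zpow_add₀ hSne, ← zpow_add₀ hSne, ← zpow_add₀ hSne]; congr 1; ring
    have q0 : S ^ (-1 : ℤ) = S⁻¹ := zpow_neg_one S
    have q1 : S ^ (-(((j + 1 : ℕ) : ℤ) + (k : ℤ))) = S ^ (-(j : ℤ)) * S⁻¹ * S ^ (-(k : ℤ)) := by
      rw [← q0, ← zpow_add₀ hSne, ← zpow_add₀ hSne]; congr 1; push_cast; ring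
    have q2 : S ^ (-((j + 1 : ℕ) : ℤ)) = S ^ (-(j : ℤ)) * S⁻¹ := by
      rw [← q0, ← zpow_add₀ hSne]; congr 1; push_cast; ring
    have q3 : S ^ (((j + 1 : ℕ) : ℤ) - 2 * (k : ℤ)) = S ^ (j : ℤ) * S * (S ^ (-(k : ℤ))) ^ 2 := by
      rw [← zz, pow_two, ← zpow_add₀ hSne, ← zpow_add₀ hSne]; congr 1; push_cast; ring
    have q4 : S ^ (((j + 1 : ℕ) : ℤ) - (k : ℤ)) = S ^ (j : ℤ) * S * S ^ (-(k : ℤ)) := by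
      rw [← zz, ← zpow_add₀ hSne]; congr 1
    have step := aux_step |lam| S S⁻¹ α β j (S ^ (j : ℤ)) (S ^ (-(j : ℤ))) (S ^ (-(k : ℤ)))
      (|lam| ^ j) hlam0 hsig (by positivity) (mul_inv_cancel₀ hSne) hLz hα hab (by positivity)
      hx hy hxy he he1 hc (by positivity) hlj
    rw [q1, q2, q3, q4]
    rw [r1] at i1
    rw [r2] at i3
    rw [r3] at i4
    rw [r4] at m2
    rw [r5] at m3
    have cj : ((j + 1 : ℕ) : ℝ) = (j : ℝ) + 1 := by push_cast; ring
    rw [cj]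
    have ent : ∀ a b, P (j + 1) a b = M j a 0 * P j 0 b + M j a 1 * P j 1 b := by
      intro a b; rw [hP, Matrix.mul_apply, Fin.sum_univ_two]
    obtain ⟨s1, s2, s3, s4⟩ := step
    have hw : |P j 1 1| ≤ S ^ (j : ℤ) + β * j * (S ^ (j : ℤ) * S ^ (-(k : ℤ))) := by
      have := abs_add_le (sig ^ j) (P j 1 1 - sig ^ j)
      rw [hsj, add_sub_cancel] at this
      linarith
    have ht : |P j 0 0| ≤ |lam| ^ j + β * j * (S ^ (-(j : ℤ)) * S ^ (-(k : ℤ))) := by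
      have := abs_add_le (lam ^ j) (P j 0 0 - lam ^ j)
      rw [abs_pow, add_sub_cancel] at this
      linarith
    refine ⟨?_, ?_, ?_, ?_⟩
    · have := aux_tri lam (lam ^ j) (ent 0 0) m1 i1 m2 i3
      rw [abs_pow] at this
      rw [pow_succ']
      exact this.trans s1
    · have := aux_tri lam 0 (ent 0 1) m1 ((congrArg abs (sub_zero _)).trans_le i2) m2 hw
      simp only [abs_zero, mul_zero, sub_zero, add_zero] at this
      exact this.trans s2
    · have := aux_tri sig 0 ((ent 1 0).trans (add_comm _ _)) m4 ((congrArg abs (sub_zero _)).trans_le i3) m3 ht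
      simp only [abs_zero, mul_zero, sub_zero, add_zero] at this
      exact this.trans s3
    · have := aux_tri sig (sig ^ j) ((ent 1 1).trans (add_comm _ _)) m4 i4 m3 i2
      rw [hsj] at this
      rw [pow_succ']
      exact this.trans s4
end

section
/- Suppose |λσ| ≤ 1 and set δ = (2^{1/3} − 1)/(2R). Then for every integer k ≥ 1 and every (x,y) ∈ ℝ² such that T₀^j(x,y) ∈ 𝒩 for all j = 0, …, k−1 and k|xy| ≤ δ, writing T₀^k(x,y) = (X, Y), one has |X − λ^k x| ≤ 2kR|λ|^k |x| |xy| and |Y − σ^k y| ≤ 2kR|σ|^k |y| |xy|. -/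
open Function

/-- Suppose `|λσ| ≤ 1` and set `δ = (2^{1/3} − 1)/(2R)`. Then for every `k ≥ 1`
and every `(x,y)` with `T₀^j(x,y) ∈ 𝒩` for `j = 0,…,k−1` and `k|xy| ≤ δ`, writing
`T₀^k(x,y) = (X,Y)`, one has `|X − λ^k x| ≤ 2kR|λ|^k|x||xy|` and
`|Y − σ^k y| ≤ 2kR|σ|^k|y||xy|`. -/
theorem stmt_10 (lam sig : ℝ) (hlam0 : 0 < |lam|) (hlam1 : |lam| < 1) (hsig : 1 < |sig|)
    (F G : ℝ × ℝ → ℝ) (hF : ContDiff ℝ (⊤ : ℕ∞) F) (hG : ContDiff ℝ (⊤ : ℕ∞) G)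
    (T₀ : ℝ × ℝ → ℝ × ℝ)
    (hT₀ : ∀ x y : ℝ, T₀ (x, y) =
      (lam * x * (1 + x * y * F (x, y)), sig * y * (1 + x * y * G (x, y))))
    (N : Set (ℝ × ℝ)) (hN : Bornology.IsBounded N)
    (R : ℝ) (hR : 0 < R)
    (hFb : ∀ p ∈ N, |F p| ≤ R) (hGb : ∀ p ∈ N, |G p| ≤ R)
    (hls : |lam * sig| ≤ 1)
    (δ : ℝ) (hδ : δ = ((2 : ℝ) ^ ((1 : ℝ) / 3) - 1) / (2 * R)) :
    ∀ k : ℕ, 1 ≤ k → ∀ x y : ℝ,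
      (∀ j < k, T₀^[j] (x, y) ∈ N) → (k : ℝ) * |x * y| ≤ δ →
      |(T₀^[k] (x, y)).1 - lam ^ k * x| ≤ 2 * (k : ℝ) * R * |lam| ^ k * |x| * |x * y| ∧
      |(T₀^[k] (x, y)).2 - sig ^ k * y| ≤ 2 * (k : ℝ) * R * |sig| ^ k * |y| * |x * y| := by
  obtain ⟨c, hc⟩ : ∃ c : ℝ, c = (2 : ℝ) ^ ((1 : ℝ) / 3) := ⟨_, rfl⟩
  have hc0 : 0 ≤ c := by rw [hc]; positivity
  have hc3 : c ^ 3 = 2 := by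
    rw [hc, ← Real.rpow_natCast, ← Real.rpow_mul (by norm_num)]
    norm_num
  rw [← hc] at hδ
  have key : ∀ k : ℕ, ∀ x y : ℝ,
      (∀ j < k, T₀^[j] (x, y) ∈ N) → (k : ℝ) * |x * y| ≤ δ →
      ∃ a b : ℝ, T₀^[k] (x, y) = (lam ^ k * x * (1 + a), sig ^ k * y * (1 + b)) ∧
        |a| ≤ 2 * k * R * |x * y| ∧ |b| ≤ 2 * k * R * |x * y| := by
    intro k
    induction k with
    | zero =>
      intro x y _ _
      exact ⟨0, 0, by simp, by simp, by simp⟩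
    | succ k ih =>
      intro x y hN' hk
      have hu := abs_nonneg (x * y)
      push_cast at hk
      have hk' : (k : ℝ) * |x * y| ≤ δ := by linarith
      obtain ⟨a, b, hT, ha, hb⟩ := ih x y (fun j hj => hN' j (by omega)) hk'
      have hp := hN' k (by omega)
      have hsmall : 2 * k * R * |x * y| ≤ c - 1 := by
        rw [hδ, le_div_iff₀ (by positivity)] at hk'
        linarith
      have ha1 : |1 + a| ≤ c := by
        have := abs_add_le 1 a
        rw [abs_one] at this; linarith
      have hb1 : |1 + b| ≤ c := by
        have := abs_add_le 1 b
        rw [abs_one] at this; linarith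
      have hFp := hFb _ hp
      have hGp := hGb _ hp
      rw [hT] at hFp hGp
      obtain ⟨w, hw⟩ : ∃ w : ℝ, w = lam ^ k * x * (1 + a) * (sig ^ k * y * (1 + b)) := ⟨_, rfl⟩
      have hwb : |w| ≤ c ^ 2 * |x * y| := by
        have e : w = (lam * sig) ^ k * ((1 + a) * (1 + b)) * (x * y) := by rw [hw]; ring
        rw [e, abs_mul, abs_mul, abs_pow, abs_mul (1 + a)]
        have h1 : |lam * sig| ^ k ≤ 1 := pow_le_one₀ (abs_nonneg _) hls
        have h2 : |1 + a| * |1 + b| ≤ c * c := by gcongr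
        have h3 : |lam * sig| ^ k * (|1 + a| * |1 + b|) ≤ 1 * (c * c) := by gcongr
        calc _ ≤ 1 * (c * c) * |x * y| := by gcongr
          _ = _ := by ring
      have step : ∀ d f : ℝ, |d| ≤ 2 * k * R * |x * y| → |1 + d| ≤ c → |f| ≤ R →
          |d + (1 + d) * (w * f)| ≤ 2 * ((k + 1 : ℕ) : ℝ) * R * |x * y| := by
        intro d f hd hd1 hf
        have h1 : |(1 + d) * (w * f)| ≤ c * (c ^ 2 * |x * y| * R) := by
          rw [abs_mul, abs_mul]; gcongr
        have h2 : c * (c ^ 2 * |x * y| * R) = 2 * R * |x * y| := by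
          rw [← hc3]; ring
        have := abs_add_le d ((1 + d) * (w * f))
        push_cast
        linarith
      refine ⟨_, _, ?_, step a _ ha ha1 hFp, step b _ hb hb1 hGp⟩
      rw [Function.iterate_succ_apply', hT, hT₀, ← hw]
      ext
      · simp only; ring
      · simp only; ring
  intro k _ x y hN' hk
  obtain ⟨a, b, hT, ha, hb⟩ := key k x y hN' hk
  rw [hT]
  constructor
  · have e : lam ^ k * x * (1 + a) - lam ^ k * x = lam ^ k * x * a := by ring
    simp only [e]
    rw [abs_mul, abs_mul, abs_pow]
    calc _ ≤ |lam| ^ k * |x| * (2 * k * R * |x * y|) := by gcongr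
      _ = _ := by ring
  · have e : sig ^ k * y * (1 + b) - sig ^ k * y = sig ^ k * y * b := by ring
    simp only [e]
    rw [abs_mul, abs_mul, abs_pow]
    calc _ ≤ |sig| ^ k * |y| * (2 * k * R * |x * y|) := by gcongr
      _ = _ := by ring
end
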